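/- arXiv:2502.00585 — 2 statements merged into one kernel-verified Lean document; each statement's English description precedes it below -/
import Mathlib

section
/- Let ν ≥ 0 be an integer and let f : ℝ → ℝ be (ν+1)-times continuously differentiable on [−1,1] with Υ = ∫_{−1}^{1} |f^{(ν+1)}(x)| dx. For k ≥ 0 define the Chebyshev coefficient μ_k = (2/π)·∫_{−1}^{1} f(x)·T_k(x)·(1−x²)^{−1/2} dx. Then for every integer κ ≥ ν + 1, |μ_κ| ≤ 2Υ / (π·(κ − ν)^{ν+1}). -/
open Polynomial Real

lemma cheb_comp_cont {g : ℝ → ℝ} (hg : ContinuousOn g (Set.Icc (-1 : ℝ) 1)) :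
    Continuous (fun θ : ℝ => g (cos θ)) :=
  hg.comp_continuous continuous_cos (fun θ => ⟨neg_one_le_cos θ, cos_le_one θ⟩)

lemma cheb_parts {f : ℝ → ℝ} (hf : ContDiffOn ℝ 1 f (Set.Icc (-1 : ℝ) 1)) {k : ℕ} (hk : 1 ≤ k) :
    ∫ θ in (0 : ℝ)..π, f (cos θ) * cos (k * θ) =
      (1 / (k : ℝ)) * ∫ θ in (0 : ℝ)..π,
        derivWithin f (Set.Icc (-1 : ℝ) 1) (cos θ) * sin θ * sin (k * θ) := by
  have hu : UniqueDiffOn ℝ (Set.Icc (-1 : ℝ) 1) := uniqueDiffOn_Icc (by norm_num)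
  have hk0 : (k : ℝ) ≠ 0 := by positivity
  have hg : ContinuousOn (derivWithin f (Set.Icc (-1 : ℝ) 1)) (Set.Icc (-1 : ℝ) 1) :=
    hf.continuousOn_derivWithin hu le_rfl
  have hgc := cheb_comp_cont hg
  have key := intervalIntegral.integral_mul_deriv_eq_deriv_mul_of_hasDerivAt
    (a := 0) (b := π) (u := fun θ => f (cos θ))
    (u' := fun θ => derivWithin f (Set.Icc (-1 : ℝ) 1) (cos θ) * (-sin θ))
    (v := fun θ => sin (k * θ) / k) (v' := fun θ => cos (k * θ))
    (cheb_comp_cont hf.continuousOn).continuousOn (by fun_prop)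
    (by
      intro x hx
      rw [min_eq_left pi_pos.le, max_eq_right pi_pos.le] at hx
      have h1 : cos x < 1 := by
        have := cos_lt_cos_of_nonneg_of_le_pi le_rfl hx.2.le hx.1
        simpa using this
      have h2 : -1 < cos x := by
        have := cos_lt_cos_of_nonneg_of_le_pi hx.1.le le_rfl hx.2
        simpa using this
      have hd : HasDerivAt f (derivWithin f (Set.Icc (-1 : ℝ) 1) (cos x)) (cos x) :=
        ((hf.differentiableOn one_ne_zero) (cos x) ⟨h2.le, h1.le⟩).hasDerivWithinAt.hasDerivAt
          (Icc_mem_nhds h2 h1)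
      exact hd.comp x (hasDerivAt_cos x))
    (by
      intro x _
      have h := (((hasDerivAt_id x).const_mul (k : ℝ)).sin).div_const (k : ℝ)
      convert h using 1
      all_goals
        simp only [id_eq, mul_one]
        try field_simp)
    ((hgc.mul continuous_sin.neg).intervalIntegrable _ _)
    ((by fun_prop : Continuous fun θ : ℝ => cos (k * θ)).intervalIntegrable _ _)
  rw [key, sin_nat_mul_pi, ← intervalIntegral.integral_const_mul]
  simp only [mul_zero, sin_zero, zero_div, sub_zero, zero_sub]
  rw [← intervalIntegral.integral_neg]
  congr 1
  ext θ
  ring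

lemma cheb_abs_int (g : ℝ → ℝ) :
    ∫ θ in (0 : ℝ)..π, |g (cos θ)| * sin θ = ∫ x in (-1 : ℝ)..1, |g x| := by
  have h := intervalIntegral.integral_comp_mul_deriv_of_deriv_nonpos (a := 0) (b := π)
    (f := cos) (f' := fun θ => -sin θ) (g := fun x => |g x|) continuous_cos.continuousOn
    (fun x _ => hasDerivAt_cos x)
    (by
      intro x hx
      rw [min_eq_left pi_pos.le, max_eq_right pi_pos.le] at hx
      have := sin_nonneg_of_mem_Icc ⟨hx.1.le, hx.2.le⟩
      simpa using this)
  rw [cos_zero, cos_pi, intervalIntegral.integral_symm (-1) 1] at h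
  simp only [Function.comp_apply, mul_neg, intervalIntegral.integral_neg] at h
  linarith

lemma cheb_main (ν : ℕ) : ∀ (f : ℝ → ℝ),
    ContDiffOn ℝ (ν + 1 : ℕ) f (Set.Icc (-1 : ℝ) 1) → ∀ k : ℕ, ν + 1 ≤ k →
    |∫ θ in (0 : ℝ)..π, f (cos θ) * cos (k * θ)| ≤
      (∫ x in (-1 : ℝ)..1, |iteratedDerivWithin (ν + 1) f (Set.Icc (-1 : ℝ) 1) x|) /
        ((k : ℝ) - ν) ^ (ν + 1) := by
  have hu : UniqueDiffOn ℝ (Set.Icc (-1 : ℝ) 1) := uniqueDiffOn_Icc (by norm_num)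
  induction ν with
  | zero =>
    intro f hf k hk
    have hf1 : ContDiffOn ℝ 1 f (Set.Icc (-1 : ℝ) 1) := by simpa using hf
    have hgc := cheb_comp_cont (hf1.continuousOn_derivWithin hu le_rfl)
    have hk0 : (0 : ℝ) < k := by exact_mod_cast hk
    rw [cheb_parts hf1 (by omega), iteratedDerivWithin_succ', iteratedDerivWithin_zero,
      ← cheb_abs_int, abs_mul, abs_of_pos (by positivity : (0 : ℝ) < 1 / k)]
    have : |∫ θ in (0 : ℝ)..π,
        derivWithin f (Set.Icc (-1 : ℝ) 1) (cos θ) * sin θ * sin (k * θ)| ≤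
        ∫ θ in (0 : ℝ)..π, |derivWithin f (Set.Icc (-1 : ℝ) 1) (cos θ)| * sin θ := by
      refine (intervalIntegral.abs_integral_le_integral_abs pi_pos.le).trans ?_
      refine intervalIntegral.integral_mono_on pi_pos.le
        (Continuous.intervalIntegrable (by fun_prop) _ _)
        (Continuous.intervalIntegrable (by fun_prop) _ _) ?_
      intro x hx
      have hs := sin_nonneg_of_mem_Icc hx
      rw [abs_mul, abs_mul, abs_of_nonneg hs]
      exact mul_le_of_le_one_right (by positivity) (abs_sin_le_one _)
    calc _ ≤ 1 / (k : ℝ) * _ := mul_le_mul_of_nonneg_left this (by positivity)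
      _ = _ := by simp; ring
  | succ ν ih =>
    intro f hf k hk
    have hf1 : ContDiffOn ℝ 1 f (Set.Icc (-1 : ℝ) 1) := hf.of_le (by
      exact_mod_cast (by omega : 1 ≤ ν + 1 + 1))
    have hg : ContDiffOn ℝ (ν + 1 : ℕ) (derivWithin f (Set.Icc (-1 : ℝ) 1))
        (Set.Icc (-1 : ℝ) 1) := hf.derivWithin hu (by norm_cast)
    have hgc := cheb_comp_cont hg.continuousOn
    obtain ⟨m, rfl⟩ : ∃ m, k = m + 1 := ⟨k - 1, by omega⟩
    rw [cheb_parts hf1 (by omega), iteratedDerivWithin_succ']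
    set g := derivWithin f (Set.Icc (-1 : ℝ) 1)
    set Y := ∫ x in (-1 : ℝ)..1, |iteratedDerivWithin (ν + 1) g (Set.Icc (-1 : ℝ) 1) x| with hY
    have hY0 : 0 ≤ Y := intervalIntegral.integral_nonneg (by norm_num) (fun _ _ => abs_nonneg _)
    have h1 := ih g hg m (by omega)
    have h2 := ih g hg (m + 2) (by omega)
    rw [← hY] at h1 h2
    have hmν : (1 : ℝ) ≤ (m : ℝ) - ν := by
      have : ((ν + 1 : ℕ) : ℝ) ≤ m := by exact_mod_cast (by omega : ν + 1 ≤ m)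
      push_cast at this; linarith
    have h3 : Y / (((m + 2 : ℕ) : ℝ) - ν) ^ (ν + 1) ≤ Y / ((m : ℝ) - ν) ^ (ν + 1) := by
      gcongr
      omega
    have hsplit : ∫ θ in (0 : ℝ)..π, g (cos θ) * sin θ * sin ((m + 1 : ℕ) * θ) =
        1 / 2 * ((∫ θ in (0 : ℝ)..π, g (cos θ) * cos (m * θ)) -
          ∫ θ in (0 : ℝ)..π, g (cos θ) * cos ((m + 2 : ℕ) * θ)) := by
      have hint : ∀ n : ℕ, IntervalIntegrable (fun θ : ℝ => g (cos θ) * cos (n * θ))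
          MeasureTheory.volume 0 π := fun n =>
        (hgc.mul (by fun_prop : Continuous fun θ : ℝ => cos (n * θ))).intervalIntegrable _ _
      rw [← intervalIntegral.integral_sub (hint m) (hint (m + 2)), ← intervalIntegral.integral_const_mul]
      congr 1
      ext θ
      have e1 : (m : ℝ) * θ = (m + 1 : ℕ) * θ - θ := by push_cast; ring
      have e2 : ((m + 2 : ℕ) : ℝ) * θ = (m + 1 : ℕ) * θ + θ := by push_cast; ring
      rw [e1, e2, cos_sub, cos_add]
      ring
    rw [hsplit]
    set A := ∫ θ in (0 : ℝ)..π, g (cos θ) * cos (m * θ)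
    set B := ∫ θ in (0 : ℝ)..π, g (cos θ) * cos ((m + 2 : ℕ) * θ)
    have hAB : |1 / 2 * (A - B)| ≤ Y / ((m : ℝ) - ν) ^ (ν + 1) := by
      rw [abs_le] at *
      constructor <;> linarith [h1.1, h1.2, h2.1, h2.2]
    have hd : (((m + 1 : ℕ) : ℝ) - (ν + 1 : ℕ)) = (m : ℝ) - ν := by push_cast; ring
    have hle : 1 / ((m + 1 : ℕ) : ℝ) ≤ 1 / ((m : ℝ) - ν) := by
      have : (0 : ℝ) ≤ ν := by positivity
      apply one_div_le_one_div_of_le (by linarith)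
      push_cast; linarith
    rw [hd, abs_mul, abs_of_nonneg (by positivity : (0 : ℝ) ≤ 1 / ((m + 1 : ℕ) : ℝ))]
    calc _ ≤ 1 / ((m : ℝ) - ν) * (Y / ((m : ℝ) - ν) ^ (ν + 1)) :=
          mul_le_mul hle hAB (abs_nonneg _) (by positivity)
      _ = _ := by
        rw [pow_succ _ (ν + 1)]
        field_simp

lemma cheb_cov (f : ℝ → ℝ) (k : ℕ) :
    ∫ x in (-1 : ℝ)..1,
        f x * (Polynomial.Chebyshev.T ℝ (k : ℤ)).eval x * (1 - x ^ 2) ^ (-(1 : ℝ) / 2) =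
      ∫ θ in (0 : ℝ)..π, f (cos θ) * cos (k * θ) := by
  have h := Polynomial.Chebyshev.integral_measureT_eq_integral_cos
    (f := fun x => f x * (Polynomial.Chebyshev.T ℝ (k : ℤ)).eval x)
  rw [Polynomial.Chebyshev.integral_measureT] at h
  simp only [Polynomial.Chebyshev.T_real_cos, Int.cast_natCast] at h
  rw [← h]
  apply intervalIntegral.integral_congr
  intro x hx
  rw [Set.uIcc_of_le (by norm_num)] at hx
  have h0 : 0 ≤ 1 - x ^ 2 := by nlinarith [hx.1, hx.2]
  have : (1 - x ^ 2) ^ (-(1 : ℝ) / 2) = √(1 - x ^ 2)⁻¹ := by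
    rw [sqrt_inv, sqrt_eq_rpow, ← rpow_neg h0]
    norm_num
  simp only [this]

/-- Chebyshev coefficient decay for differentiable functions (Theorem 1(1)):
if `f` is `(ν+1)`-times continuously differentiable on `[-1,1]` and
`Υ = ∫_{-1}^{1} |f^{(ν+1)}|`, then for every `κ ≥ ν + 1` the `κ`-th Chebyshev
coefficient satisfies `|μ_κ| ≤ 2Υ / (π (κ - ν)^{ν+1})`. -/
theorem chebyshev_coeff_bound_differentiable
    (ν : ℕ) (f : ℝ → ℝ)
    (hf : ContDiffOn ℝ (ν + 1 : ℕ) f (Set.Icc (-1 : ℝ) 1))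
    (Υ : ℝ)
    (hΥ : Υ = ∫ x in (-1 : ℝ)..1,
      |iteratedDerivWithin (ν + 1) f (Set.Icc (-1 : ℝ) 1) x|)
    (μ : ℕ → ℝ)
    (hμ : ∀ k : ℕ, μ k = (2 / Real.pi) *
      ∫ x in (-1 : ℝ)..1,
        f x * (Polynomial.Chebyshev.T ℝ (k : ℤ)).eval x * (1 - x ^ 2) ^ (-(1 : ℝ) / 2)) :
    ∀ κ : ℕ, ν + 1 ≤ κ →
      |μ κ| ≤ 2 * Υ / (Real.pi * ((κ : ℝ) - (ν : ℝ)) ^ (ν + 1)) := by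
  intro κ hκ
  have h := cheb_main ν f hf κ hκ
  rw [hμ, cheb_cov, abs_mul, abs_of_pos (by positivity), hΥ]
  calc _ ≤ 2 / π * _ := mul_le_mul_of_nonneg_left h (by positivity)
    _ = _ := by rw [div_mul_div_comm]
end

section
/- Let ν ≥ 1 be an integer and let f : ℝ → ℝ be (ν+1)-times continuously differentiable on [−1,1] with Υ = ∫_{−1}^{1} |f^{(ν+1)}(x)| dx. Let κ > ν be an integer, let x_j = cos(jπ/κ) for j = 0, 1, …, κ be the Chebyshev points, and let p be the unique polynomial of degree at most κ with p(x_j) = f(x_j) for all j (the Chebyshev interpolant of f of degree κ). Then sup_{x ∈ [−1,1]} |f(x) − p(x)| ≤ 4Υ / (π·ν·(κ − ν)^{ν}). -/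
open Polynomial Real

namespace ChebAux

lemma hasSum_congr_aux {ι E : Type*} [AddCommMonoid E] [TopologicalSpace E] {f g : ι → E} {a : E}
    (h : ∀ i, f i = g i) : HasSum f a ↔ HasSum g a := by
  rw [funext h]

/-- Fourier coefficient. -/
noncomputable def co (h : ℝ → ℂ) (n : ℤ) : ℂ :=
  (1 / (2 * (π : ℂ))) * ∫ θ in (0 : ℝ)..(2 * π), Complex.exp (-((n : ℂ) * θ * Complex.I)) * h θ

lemma hasDeriv_exp (n : ℤ) (x : ℝ) :
    HasDerivAt (fun θ : ℝ => Complex.exp (-((n : ℂ) * θ * Complex.I)))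
      (-((n : ℂ) * Complex.I) * Complex.exp (-((n : ℂ) * x * Complex.I))) x := by
  have h1 : HasDerivAt (fun θ : ℝ => (θ : ℂ)) 1 x := Complex.ofRealCLM.hasDerivAt
  have h2 : HasDerivAt (fun θ : ℝ => -((n : ℂ) * θ * Complex.I)) (-((n : ℂ) * 1 * Complex.I)) x :=
    ((h1.const_mul (n : ℂ)).mul_const Complex.I).neg
  have h3 := h2.cexp
  convert h3 using 1
  ring

lemma exp_two_pi (n : ℤ) : Complex.exp (-((n : ℂ) * ((2 * π : ℝ) : ℂ) * Complex.I)) = 1 := by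
  rw [Complex.exp_eq_one_iff]
  exact ⟨-n, by push_cast; ring⟩

lemma co_deriv (h h' : ℝ → ℂ) (hd : ∀ x, HasDerivAt h (h' x) x) (hc : Continuous h')
    (hp : h (2 * π) = h 0) (n : ℤ) : co h' n = (n : ℂ) * Complex.I * co h n := by
  unfold co
  rw [intervalIntegral.integral_mul_deriv_eq_deriv_mul (fun x _ => hasDeriv_exp n x)
    (fun x _ => hd x) (by apply Continuous.intervalIntegrable; fun_prop)
    (hc.intervalIntegrable _ _), exp_two_pi, hp]
  simp only [mul_assoc, neg_mul]
  rw [intervalIntegral.integral_neg, intervalIntegral.integral_const_mul,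
    intervalIntegral.integral_const_mul]
  simp
  ring

lemma co_sin (G : ℝ → ℂ) (hG : Continuous G) (n : ℤ) :
    co (fun θ => G θ * (-(Real.sin θ : ℂ))) n
      = Complex.I / 2 * (co G (n - 1) - co G (n + 1)) := by
  unfold co
  rw [← mul_sub, ← intervalIntegral.integral_sub (by apply Continuous.intervalIntegrable; fun_prop)
    (by apply Continuous.intervalIntegrable; fun_prop), mul_left_comm]
  congr 1
  rw [← intervalIntegral.integral_const_mul]
  apply intervalIntegral.integral_congr
  intro θ _
  simp only
  have e1 : Complex.exp (-(((n - 1 : ℤ) : ℂ) * θ * Complex.I))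
      = Complex.exp (-((n : ℂ) * θ * Complex.I)) * Complex.exp (θ * Complex.I) := by
    rw [← Complex.exp_add]; congr 1; push_cast; ring
  have e2 : Complex.exp (-(((n + 1 : ℤ) : ℂ) * θ * Complex.I))
      = Complex.exp (-((n : ℂ) * θ * Complex.I)) * Complex.exp (-θ * Complex.I) := by
    rw [← Complex.exp_add]; congr 1; push_cast; ring
  rw [e1, e2, Complex.ofReal_sin, Complex.sin]
  ring

/-- Both substitutions give the total integral. -/
lemma sub_int (φ : ℝ → ℝ) (hφ : ContinuousOn φ (Set.Icc (-1) 1)) :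
    ∫ θ in (0 : ℝ)..(2 * π), φ (cos θ) * |sin θ| = 2 * ∫ x in (-1 : ℝ)..1, φ x := by
  have hcc : Continuous (fun θ => φ (cos θ)) :=
    hφ.comp_continuous Real.continuous_cos (fun x => ⟨neg_one_le_cos x, cos_le_one x⟩)
  have key : ∀ a b : ℝ, ∫ θ in a..b, φ (cos θ) * (-sin θ) = ∫ x in (cos a)..(cos b), φ x := by
    intro a b
    apply intervalIntegral.integral_comp_mul_deriv'' (f := cos) (g := φ)
    · fun_prop
    · intro x _; exact (Real.hasDerivAt_cos x).hasDerivWithinAt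
    · fun_prop
    · apply hφ.mono
      rintro _ ⟨x, _, rfl⟩
      exact ⟨neg_one_le_cos x, cos_le_one x⟩
  have hi : ∀ a b : ℝ, IntervalIntegrable (fun θ => φ (cos θ) * |sin θ|) MeasureTheory.volume a b :=
    fun a b => (hcc.mul (by fun_prop)).intervalIntegrable a b
  rw [← intervalIntegral.integral_add_adjacent_intervals (hi 0 π) (hi π (2 * π))]
  have h1 : ∫ θ in (0 : ℝ)..π, φ (cos θ) * |sin θ| = ∫ x in (-1 : ℝ)..1, φ x := by
    have := key π 0
    rw [cos_pi, cos_zero, intervalIntegral.integral_symm, ← intervalIntegral.integral_neg] at this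
    rw [← this]
    apply intervalIntegral.integral_congr
    intro θ hθ
    rw [Set.uIcc_of_le pi_pos.le] at hθ
    simp only
    rw [abs_of_nonneg (sin_nonneg_of_mem_Icc hθ)]; ring
  have h2 : ∫ θ in π..(2 * π), φ (cos θ) * |sin θ| = ∫ x in (-1 : ℝ)..1, φ x := by
    have := key π (2 * π)
    rw [cos_pi, cos_two_pi] at this
    rw [← this]
    apply intervalIntegral.integral_congr
    intro θ hθ
    rw [Set.uIcc_of_le (by linarith [pi_pos])] at hθ
    have : sin θ ≤ 0 := by
      have := sin_nonneg_of_nonneg_of_le_pi (x := θ - π) (by linarith [hθ.1]) (by linarith [hθ.2])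
      rw [sin_sub_pi] at this
      linarith
    simp only
    rw [abs_of_nonpos this]
  rw [h1, h2]; ring

lemma co_norm_le (h : ℝ → ℝ) (n : ℤ) :
    ‖co (fun θ => (h θ : ℂ)) n‖ ≤ (1 / (2 * π)) * ∫ θ in (0 : ℝ)..(2 * π), |h θ| := by
  unfold co
  rw [norm_mul]
  have : ‖(1 / (2 * (π : ℂ)))‖ = 1 / (2 * π) := by
    simp [abs_of_pos pi_pos]
  rw [this]
  gcongr
  refine (intervalIntegral.norm_integral_le_integral_norm (by positivity)).trans (le_of_eq ?_)
  apply intervalIntegral.integral_congr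
  intro θ _
  have : ‖Complex.exp (-((n : ℂ) * θ * Complex.I))‖ = 1 := by
    have := Complex.norm_exp_ofReal_mul_I (-(n * θ))
    rw [← this]; congr 2; push_cast; ring
  simp only [norm_mul, this]; simp

/-- Coefficient bounds. -/
lemma co_bound (F : ℕ → ℝ → ℝ) (ν : ℕ)
    (hF : ∀ i ≤ ν, ∀ x ∈ Set.Icc (-1 : ℝ) 1, HasDerivWithinAt (F i) (F (i + 1) x) (Set.Icc (-1) 1) x)
    (hFc : ∀ i ≤ ν + 1, ContinuousOn (F i) (Set.Icc (-1 : ℝ) 1)) (i : ℕ) :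
    ∀ j, i + j = ν → ∀ n : ℤ, i + 1 ≤ n.natAbs →
      ‖co (fun θ => (F j (cos θ) : ℂ)) n‖
        ≤ (∫ x in (-1 : ℝ)..1, |F (ν + 1) x|) / π * (1 / (n.natAbs.descFactorial (i + 1) : ℝ)) := by
  have hmem : ∀ x : ℝ, cos x ∈ Set.Icc (-1 : ℝ) 1 := fun x => ⟨neg_one_le_cos x, cos_le_one x⟩
  have hcont : ∀ i ≤ ν + 1, Continuous (fun θ => F i (cos θ)) := fun i hi =>
    (hFc i hi).comp_continuous Real.continuous_cos hmem
  have hder : ∀ j ≤ ν, ∀ n : ℤ, co (fun θ => (F (j + 1) (cos θ) : ℂ) * (-(Real.sin θ : ℂ))) n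
      = (n : ℂ) * Complex.I * co (fun θ => (F j (cos θ) : ℂ)) n := by
    intro j hj n
    apply co_deriv
    · intro x
      have := ((hF j hj (cos x) (hmem x)).comp_hasDerivAt x (Real.hasDerivAt_cos x)
        (Filter.Eventually.of_forall hmem)).ofReal_comp
      rw [Complex.ofReal_mul, Complex.ofReal_neg] at this
      exact this
    · have := hcont (j + 1) (by omega)
      exact (Complex.continuous_ofReal.comp this).mul
        (Complex.continuous_ofReal.comp Real.continuous_sin).neg
    · simp
  have hV : 0 ≤ ∫ x in (-1 : ℝ)..1, |F (ν + 1) x| :=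
    intervalIntegral.integral_nonneg (by norm_num) (fun _ _ => abs_nonneg _)
  have habs : ∀ n : ℤ, ‖(n : ℂ)‖ = (n.natAbs : ℝ) := by
    intro n; rw [Complex.norm_intCast, Nat.cast_natAbs, Int.cast_abs]
  induction i with
  | zero =>
    intro j hj n hn
    obtain rfl : j = ν := by omega
    have h1 := hder j le_rfl n
    have h2 := co_norm_le (fun θ => F (j + 1) (cos θ) * (-(Real.sin θ))) n
    have h3 := sub_int (fun x => |F (j + 1) x|) (hFc (j + 1) le_rfl).abs
    simp only [abs_mul, abs_neg] at h2
    rw [h3] at h2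
    push_cast at h2
    push_cast at h1
    rw [h1, norm_mul, norm_mul, habs] at h2
    have hn0 : (0 : ℝ) < n.natAbs := by exact_mod_cast hn
    simp only [zero_add, Nat.descFactorial_one, Complex.norm_I, mul_one] at h2 ⊢
    rw [mul_one_div, le_div_iff₀ hn0]
    rw [mul_comm]
    refine h2.trans (le_of_eq ?_)
    field_simp
  | succ i ih =>
    intro j hj n hn
    have h1 := hder j (by omega) n
    have hcc := hcont (j + 1) (by omega)
    rw [co_sin (fun θ => (F (j + 1) (cos θ) : ℂ)) (Complex.continuous_ofReal.comp hcc) n] at h1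
    obtain ⟨k, hk⟩ : ∃ k, n.natAbs = k + 1 := ⟨n.natAbs - 1, by omega⟩
    have hk1 : i + 1 ≤ k := by omega
    have hDpos : (0 : ℝ) < k.descFactorial (i + 1) := by
      exact_mod_cast Nat.pos_of_ne_zero (fun h => by rw [Nat.descFactorial_eq_zero_iff_lt] at h; omega)
    have hb : ∀ m : ℤ, k ≤ m.natAbs → ‖co (fun θ => (F (j + 1) (cos θ) : ℂ)) m‖ ≤
        (∫ x in (-1 : ℝ)..1, |F (ν + 1) x|) / π * (1 / (k.descFactorial (i + 1) : ℝ)) := by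
      intro m hm
      refine (ih (j + 1) (by omega) m (by omega)).trans ?_
      have : (k.descFactorial (i + 1) : ℝ) ≤ m.natAbs.descFactorial (i + 1) := by
        exact_mod_cast Nat.descFactorial_le _ hm
      gcongr
    have hb1 := hb (n - 1) (by omega)
    have hb2 := hb (n + 1) (by omega)
    have h4 := congrArg norm h1
    rw [norm_mul, norm_mul, norm_mul, habs] at h4
    have h5 := norm_sub_le (co (fun θ => (F (j + 1) (cos θ) : ℂ)) (n - 1))
      (co (fun θ => (F (j + 1) (cos θ) : ℂ)) (n + 1))
    have h6 : ‖(Complex.I / 2 : ℂ)‖ = 1 / 2 := by simp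
    rw [h6, hk, Complex.norm_I, mul_one] at h4
    rw [hk, Nat.succ_descFactorial_succ]
    have hk0 : (0 : ℝ) < ((k + 1 : ℕ) : ℝ) := by positivity
    push_cast at hk0 h4 ⊢
    have h7 : ((k : ℝ) + 1) * ‖co (fun θ => (F j (cos θ) : ℂ)) n‖ ≤
      (∫ x in (-1 : ℝ)..1, |F (ν + 1) x|) / π * (1 / (k.descFactorial (i + 1) : ℝ)) := by
      rw [← h4]; linarith
    have h8 := (le_div_iff₀' hk0).2 h7
    refine h8.trans (le_of_eq ?_)
    field_simp

lemma hasSum_nat (ν κ : ℕ) (hν : 1 ≤ ν) (hκ : ν < κ) :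
    HasSum (fun k : ℕ => 1 / ((k + κ + 1).descFactorial (ν + 1) : ℝ))
      (1 / ((ν : ℝ) * κ.descFactorial ν)) := by
  have hν0 : (0 : ℝ) < ν := by exact_mod_cast hν
  have hpos : ∀ k : ℕ, (0 : ℝ) < ((k + κ).descFactorial ν : ℝ) := by
    intro k
    exact_mod_cast Nat.pos_of_ne_zero (fun h => by rw [Nat.descFactorial_eq_zero_iff_lt] at h; omega)
  have hstep : ∀ k : ℕ, 1 / ((k + κ + 1).descFactorial (ν + 1) : ℝ)
      = 1 / (ν * ((k + κ).descFactorial ν : ℝ)) - 1 / (ν * ((k + 1 + κ).descFactorial ν : ℝ)) := by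
    intro k
    have e1 := Nat.succ_descFactorial_succ (k + κ) ν
    have e2 := Nat.descFactorial_succ (k + κ + 1) ν
    have e1' : ((k + κ + 1).descFactorial (ν + 1) : ℝ) = (k + κ + 1) * (k + κ).descFactorial ν := by
      exact_mod_cast e1
    have e2' : ((k + κ + 1).descFactorial (ν + 1) : ℝ)
        = (k + κ + 1 - ν) * (k + κ + 1).descFactorial ν := by
      rw [e2]; push_cast [Nat.cast_sub (show ν ≤ k + κ + 1 by omega)]; ring
    have p1 := hpos k
    have p2 := hpos (k + 1)
    rw [show k + 1 + κ = k + κ + 1 by ring] at p2 ⊢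
    have p3 : (0 : ℝ) < k + κ + 1 := by positivity
    have p4 : (0 : ℝ) < k + κ + 1 - ν := by
      have : (ν : ℝ) < κ := by exact_mod_cast hκ
      have : (0 : ℝ) ≤ k := by positivity
      linarith
    rw [e1'] at e2'
    rw [e1']
    generalize ((k + κ).descFactorial ν : ℝ) = A at *
    generalize ((k + κ + 1).descFactorial ν : ℝ) = B at *
    have : A = (k + κ + 1 - ν) * B / (k + κ + 1) := by field_simp; linarith
    subst this
    field_simp
    ring
  rw [hasSum_iff_tendsto_nat_of_nonneg (fun i => by positivity)]
  simp_rw [hstep]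
  simp_rw [Finset.sum_range_sub' (fun k : ℕ => 1 / (ν * ((k + κ).descFactorial ν : ℝ)))]
  simp only [zero_add]
  suffices hz : Filter.Tendsto (fun n : ℕ => 1 / ((ν : ℝ) * (n + κ).descFactorial ν))
      Filter.atTop (nhds 0) by
    have hz' := hz.const_sub (1 / ((ν : ℝ) * κ.descFactorial ν))
    rw [sub_zero] at hz'
    exact hz'
  have hlin : Filter.Tendsto (fun n : ℕ => 1 / ((n : ℝ) + 1)) Filter.atTop (nhds 0) :=
    tendsto_one_div_add_atTop_nhds_zero_nat
  refine squeeze_zero (fun n => by positivity) (fun n => ?_) hlin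
  apply one_div_le_one_div_of_le (by positivity)
  have hd : n + 1 ≤ (n + κ).descFactorial ν := by
    calc n + 1 ≤ n + κ + 1 - ν := by omega
      _ ≤ (n + κ + 1 - ν) ^ ν := Nat.le_self_pow (by omega) _
      _ ≤ _ := Nat.pow_sub_le_descFactorial _ _
  have hd' : (n : ℝ) + 1 ≤ (n + κ).descFactorial ν := by exact_mod_cast hd
  have : (1 : ℝ) ≤ ν := by exact_mod_cast hν
  nlinarith

/-- Majorant. -/
noncomputable def maj (ν κ : ℕ) (n : ℤ) : ℝ :=
  if n.natAbs ≤ κ then 0 else 1 / (n.natAbs.descFactorial (ν + 1) : ℝ)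

lemma hasSum_maj (ν κ : ℕ) (hν : 1 ≤ ν) (hκ : ν < κ) :
    HasSum (maj ν κ) (2 / ((ν : ℝ) * κ.descFactorial ν)) := by
  have h1 : HasSum (fun k : ℕ => maj ν κ (k + 1)) (1 / ((ν : ℝ) * κ.descFactorial ν)) := by
    rw [← hasSum_nat_add_iff' κ]
    have : ∑ i ∈ Finset.range κ, maj ν κ (i + 1) = 0 := by
      apply Finset.sum_eq_zero
      intro i hi
      rw [Finset.mem_range] at hi
      unfold maj
      rw [if_pos (by omega)]
    rw [this, sub_zero]
    refine (hasSum_congr_aux fun k => ?_).mpr (hasSum_nat ν κ hν hκ)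
    unfold maj
    have : (((k + κ : ℕ) : ℤ) + 1).natAbs = k + κ + 1 := by omega
    rw [this, if_neg (by omega)]
  have h2 : HasSum (fun k : ℕ => maj ν κ (-(k + 1))) (1 / ((ν : ℝ) * κ.descFactorial ν)) := by
    refine (hasSum_congr_aux fun k => ?_).mpr h1
    unfold maj
    rw [Int.natAbs_neg]
  have h0 : maj ν κ 0 = 0 := by simp [maj]
  have := h1.of_add_one_of_neg_add_one h2
  rw [h0] at this
  convert this using 1
  ring

lemma series (h : ℝ → ℂ) (hc : Continuous h) (hp : Function.Periodic h (2 * π))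
    (hs : Summable (co h)) (θ : ℝ) :
    HasSum (fun n : ℤ => co h n * Complex.exp (n * θ * Complex.I)) (h θ) := by
  have : Fact (0 < 2 * π) := ⟨by positivity⟩
  have hcl : Continuous (hp.lift : AddCircle (2 * π) → ℂ) := continuous_quot_lift _ hc
  let g : C(AddCircle (2 * π), ℂ) := ⟨hp.lift, hcl⟩
  have hpi : (π : ℂ) ≠ 0 := by exact_mod_cast pi_ne_zero
  have hg : fourierCoeff (g : AddCircle (2 * π) → ℂ) = co h := by
    ext n
    rw [fourierCoeff_eq_intervalIntegral _ n 0, co, zero_add, Complex.real_smul]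
    push_cast
    congr 1
    apply intervalIntegral.integral_congr
    intro x _
    simp only [fourier_coe_apply, smul_eq_mul]
    change _ * hp.lift (x : AddCircle (2 * π)) = _
    rw [Function.Periodic.lift_coe]
    congr 2
    push_cast
    field_simp
  have := has_pointwise_sum_fourier_series_of_summable (f := g) (by rw [hg]; exact hs)
    (θ : AddCircle (2 * π))
  rw [hg] at this
  have hgθ : g (θ : AddCircle (2 * π)) = h θ := Function.Periodic.lift_coe hp θ
  rw [hgθ] at this
  refine (hasSum_congr_aux fun n => ?_).mpr this
  rw [fourier_coe_apply, smul_eq_mul]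
  congr 2
  push_cast
  field_simp

lemma series_cos (h : ℝ → ℂ) (hc : Continuous h) (hp : Function.Periodic h (2 * π))
    (hs : Summable (co h)) (he : ∀ θ, h (-θ) = h θ) (θ : ℝ) :
    HasSum (fun n : ℤ => co h n * (cos (n * θ) : ℂ)) (h θ) := by
  have h1 := series h hc hp hs θ
  have h2 := series h hc hp hs (-θ)
  rw [he] at h2
  have h3 := (h1.add h2).div_const 2
  rw [add_self_div_two] at h3
  refine (hasSum_congr_aux fun n => ?_).mpr h3
  rw [Complex.ofReal_cos]
  unfold Complex.cos
  push_cast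
  rw [mul_neg]
  ring

lemma alias_exists (κ : ℕ) (hκ : 0 < κ) (n : ℤ) : ∃ m : ℤ, m.natAbs ≤ κ ∧
    (n.natAbs ≤ κ → m = n) ∧ ∀ j : ℕ, cos (n * (j * π / κ)) = cos (m * (j * π / κ)) := by
  by_cases hn : n.natAbs ≤ κ
  · exact ⟨n, hn, fun _ => rfl, fun _ => rfl⟩
  have hκ0 : (κ : ℝ) ≠ 0 := by positivity
  have h0 := Int.emod_nonneg n (show (2 * κ : ℤ) ≠ 0 by omega)
  have h1 := Int.emod_lt_of_pos n (show (0 : ℤ) < 2 * κ by omega)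
  have h2 := Int.emod_add_mul_ediv n (2 * κ)
  set r := n % (2 * κ) with hr
  set q := n / (2 * κ) with hq
  have key : ∀ j : ℕ, cos (n * (j * π / κ)) = cos (r * (j * π / κ)) := by
    intro j
    rw [← Real.cos_add_int_mul_two_pi (r * (j * π / κ)) (q * j)]
    congr 1
    rw [← h2]
    push_cast
    field_simp
  by_cases hrk : r ≤ κ
  · exact ⟨r, by omega, fun h => absurd h hn, key⟩
  · refine ⟨r - 2 * κ, by omega, fun h => absurd h hn, fun j => ?_⟩
    rw [key, ← Real.cos_sub_int_mul_two_pi _ j]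
    congr 1
    push_cast
    field_simp

end ChebAux

/-- Chebyshev interpolation error bound for differentiable functions (Theorem 1(2)):
if `f` is `(ν+1)`-times continuously differentiable on `[-1,1]` with
`Υ = ∫_{-1}^{1} |f^{(ν+1)}|`, `ν ≥ 1`, and `p` is the degree-`κ` polynomial (`κ > ν`)
interpolating `f` at the Chebyshev points `x_j = cos(jπ/κ)`, then
`|f(x) - p(x)| ≤ 4Υ / (π ν (κ - ν)^ν)` on `[-1,1]`. -/
theorem chebyshev_interpolation_error_differentiable
    (ν : ℕ) (hν : 1 ≤ ν) (f : ℝ → ℝ)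
    (hf : ContDiffOn ℝ (ν + 1 : ℕ) f (Set.Icc (-1 : ℝ) 1))
    (Υ : ℝ)
    (hΥ : Υ = ∫ x in (-1 : ℝ)..1,
      |iteratedDerivWithin (ν + 1) f (Set.Icc (-1 : ℝ) 1) x|)
    (κ : ℕ) (hκ : ν < κ)
    (p : Polynomial ℝ)
    (hdeg : p.degree ≤ κ)
    (hinterp : ∀ j : ℕ, j ≤ κ →
      p.eval (Real.cos (j * Real.pi / κ)) = f (Real.cos (j * Real.pi / κ))) :
    ∀ x : ℝ, x ∈ Set.Icc (-1 : ℝ) 1 →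
      |f x - p.eval x| ≤ 4 * Υ / (Real.pi * (ν : ℝ) * ((κ : ℝ) - (ν : ℝ)) ^ ν) := by
  set S : Set ℝ := Set.Icc (-1 : ℝ) 1 with hS
  have hmem : ∀ x : ℝ, cos x ∈ S := fun x => ⟨neg_one_le_cos x, cos_le_one x⟩
  have hU : UniqueDiffOn ℝ S := uniqueDiffOn_Icc (by norm_num)
  set F : ℕ → ℝ → ℝ := fun i => iteratedDerivWithin i f S with hFdef
  have hF0 : F 0 = f := iteratedDerivWithin_zero
  have hFc : ∀ i ≤ ν + 1, ContinuousOn (F i) S := fun i hi =>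
    hf.continuousOn_iteratedDerivWithin (by exact_mod_cast hi) hU
  have hFd : ∀ i ≤ ν, ∀ x ∈ S, HasDerivWithinAt (F i) (F (i + 1) x) S x := by
    intro i hi x hx
    have := (hf.differentiableOn_iteratedDerivWithin (m := i)
      (by exact_mod_cast Nat.lt_succ_of_le hi) hU x hx).hasDerivWithinAt
    rw [← iteratedDerivWithin_succ] at this
    exact this
  have hV : 0 ≤ Υ := by
    rw [hΥ]
    exact intervalIntegral.integral_nonneg (by norm_num) (fun _ _ => abs_nonneg _)
  set h : ℝ → ℂ := fun θ => (f (cos θ) : ℂ) with hh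
  have hbound : ∀ n : ℤ, ν + 1 ≤ n.natAbs →
      ‖ChebAux.co h n‖ ≤ Υ / π * (1 / (n.natAbs.descFactorial (ν + 1) : ℝ)) := by
    intro n hn
    have := ChebAux.co_bound F ν hFd hFc ν 0 (by omega) n hn
    rw [hF0, ← hΥ] at this
    exact this
  have hmaj := (ChebAux.hasSum_maj ν κ hν hκ).mul_left (Υ / π)
  have hs : Summable (ChebAux.co h) := by
    refine Summable.of_norm_bounded_eventually hmaj.summable ?_
    have hfin : (Set.Icc (-(κ : ℤ)) κ).Finite := Set.finite_Icc _ _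
    filter_upwards [hfin.compl_mem_cofinite] with n hn
    have hn' : ¬ n.natAbs ≤ κ := fun hle => hn ⟨by omega, by omega⟩
    rw [ChebAux.maj, if_neg hn']
    exact hbound n (by omega)
  have hcont : Continuous h := by
    have := (hFc 0 (by omega)).comp_continuous Real.continuous_cos hmem
    rw [hF0] at this
    exact Complex.continuous_ofReal.comp this
  have hser := ChebAux.series_cos h hcont (fun θ => by simp [hh]) hs (fun θ => by simp [hh])
  intro x hx
  obtain ⟨θ, rfl⟩ : ∃ θ, cos θ = x := ⟨arccos x, cos_arccos hx.1 hx.2⟩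
  have hκ0 : 0 < κ := by omega
  have hκR : (0 : ℝ) < κ := by exact_mod_cast hκ0
  -- Lagrange weights
  set v : ℕ → ℝ := fun j => cos (j * π / κ) with hv
  set s : Finset ℕ := Finset.range (κ + 1) with hs'
  have hinj : Set.InjOn v (s : Set ℕ) := by
    have hI : ∀ j ∈ (s : Set ℕ), (j : ℝ) * π / κ ∈ Set.Icc 0 π := by
      intro j hj
      have hj' : j ≤ κ := by simpa [hs', Nat.lt_succ_iff] using hj
      have hj2 : (j : ℝ) ≤ κ := by exact_mod_cast hj'
      refine ⟨by positivity, ?_⟩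
      rw [div_le_iff₀ hκR]
      nlinarith [pi_pos]
    intro a ha b hb hab
    have := injOn_cos (hI a ha) (hI b hb) hab
    have h2 : (a : ℝ) = b := by
      field_simp at this
      exact this
    exact_mod_cast h2
  set w : ℕ → ℝ := fun j => (Lagrange.basis s v j).eval (cos θ) with hw
  have hLag : ∀ q : Polynomial ℝ, q.degree ≤ κ →
      q.eval (cos θ) = ∑ j ∈ s, q.eval (v j) * w j := by
    intro q hq
    have hq' : q.degree < (s.card : WithBot ℕ) := by
      rw [hs', Finset.card_range]
      exact lt_of_le_of_lt hq (by exact_mod_cast Nat.lt_succ_self κ)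
    have := Lagrange.eq_interpolate hinj hq'
    conv_lhs => rw [this]
    rw [Lagrange.interpolate_apply, Polynomial.eval_finsetSum]
    simp [hw]
  have hp : p.eval (cos θ) = ∑ j ∈ s, f (v j) * w j := by
    rw [hLag p hdeg]
    refine Finset.sum_congr rfl fun j hj => ?_
    rw [hinterp j (by simpa [hs', Nat.lt_succ_iff] using hj)]
  have hsum := (hser θ).sub (hasSum_sum (s := s) fun j _ =>
    (hser (j * π / κ)).mul_right ((w j : ℝ) : ℂ))
  have hval : h θ - ∑ j ∈ s, h (j * π / κ) * ((w j : ℝ) : ℂ)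
      = ((f (cos θ) - p.eval (cos θ) : ℝ) : ℂ) := by
    rw [hp]; push_cast; rfl
  rw [hval] at hsum
  have hfinal := hsum.norm_le_of_bounded (hmaj.mul_left 2) (fun n => by
    obtain ⟨m, hm1, hm2, hm3⟩ := ChebAux.alias_exists κ hκ0 n
    have hT := hLag (Polynomial.Chebyshev.T ℝ m) (by
      rw [Polynomial.Chebyshev.degree_T]; exact_mod_cast hm1)
    simp only [hv, Polynomial.Chebyshev.T_real_cos, ← hm3] at hT
    have e : ChebAux.co h n * ((cos (n * θ) : ℝ) : ℂ)
        - ∑ j ∈ s, ChebAux.co h n * ((cos (n * (j * π / κ)) : ℝ) : ℂ) * ((w j : ℝ) : ℂ)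
        = ChebAux.co h n * ((cos (n * θ) - cos (m * θ) : ℝ) : ℂ) := by
      rw [hT, Complex.ofReal_sub, Complex.ofReal_sum, mul_sub, Finset.mul_sum]
      congr 1
      refine Finset.sum_congr rfl fun j _ => ?_
      push_cast; ring
    rw [e, norm_mul, Complex.norm_real, Real.norm_eq_abs, ChebAux.maj]
    by_cases hn : n.natAbs ≤ κ
    · rw [if_pos hn, hm2 hn]; simp
    · rw [if_neg hn]
      have h2 : |cos (n * θ) - cos (m * θ)| ≤ 2 := by
        rw [abs_le]
        constructor <;> linarith [neg_one_le_cos (n * θ), cos_le_one (n * θ),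
          neg_one_le_cos (m * θ), cos_le_one (m * θ)]
      rw [mul_comm (2 : ℝ)]
      exact mul_le_mul (hbound n (by omega)) h2 (abs_nonneg _) (by positivity))
  rw [Complex.norm_real, Real.norm_eq_abs] at hfinal
  refine hfinal.trans ?_
  have hνR : (0 : ℝ) < ν := by exact_mod_cast hν
  have hsub : (0 : ℝ) < (κ : ℝ) - ν := by
    have : (ν : ℝ) < κ := by exact_mod_cast hκ
    linarith
  have hpow : ((κ : ℝ) - ν) ^ ν ≤ (κ.descFactorial ν : ℝ) := by
    rw [← Nat.cast_sub hκ.le]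
    have : (κ - ν) ^ ν ≤ κ.descFactorial ν :=
      (Nat.pow_le_pow_left (by omega) ν).trans (Nat.pow_sub_le_descFactorial κ ν)
    exact_mod_cast this
  have hq : (0 : ℝ) < ((κ : ℝ) - ν) ^ ν := by positivity
  calc 2 * (Υ / π * (2 / ((ν : ℝ) * κ.descFactorial ν)))
      = 4 * Υ / (π * ν * κ.descFactorial ν) := by
        have : (0 : ℝ) < κ.descFactorial ν := hq.trans_le hpow
        field_simp; ring
    _ ≤ _ := by gcongr
end
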